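/- The space V^m(𝒲) is strongly locally contractible: for every μ ∈ V^m(𝒲) and every neighborhood U of μ in V^m(𝒲), there exists a neighborhood V of μ in V^m(𝒲) with V ⊆ U such that V, with the subspace topology, is a contractible topological space. -/

import Mathlib

open MeasureTheory Set

/-- The support of a probability measure: the set of points all of whose open
neighborhoods have positive measure. -/
def msupp {X : Type*} [TopologicalSpace X] [MeasurableSpace X]
    (μ : ProbabilityMeasure X) : Set X :=
  {x | ∀ U : Set X, IsOpen U → x ∈ U → μ.toMeasure U ≠ 0}

/-- The Vietoris metric thickening of a cover `𝒲`. -/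
def VietorisThickening {X : Type*} [TopologicalSpace X] [MeasurableSpace X]
    (𝒲 : Set (Set X)) : Set (ProbabilityMeasure X) :=
  {μ | (msupp μ).Finite ∧ ∃ W ∈ 𝒲, msupp μ ⊆ W}

open Topology

section ConvexCombination

variable {X : Type*} [MeasurableSpace X]

/-- The convex combination `(1 - t) μ + t ν` of two probability measures. -/
noncomputable def MeasureTheory.ProbabilityMeasure.mix (t : unitInterval)
    (μ ν : ProbabilityMeasure X) : ProbabilityMeasure X :=
  ⟨ENNReal.ofReal (1 - t) • (μ : Measure X) + ENNReal.ofReal t • (ν : Measure X), ⟨by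
    have h₁ : (0 : ℝ) ≤ 1 - t := sub_nonneg.2 t.2.2
    simp [← ENNReal.ofReal_add h₁ t.2.1]⟩⟩

lemma MeasureTheory.ProbabilityMeasure.toMeasure_mix (t : unitInterval)
    (μ ν : ProbabilityMeasure X) :
    (μ.mix t ν : Measure X) =
      ENNReal.ofReal (1 - t) • (μ : Measure X) + ENNReal.ofReal t • (ν : Measure X) :=
  rfl

@[simp]
lemma MeasureTheory.ProbabilityMeasure.mix_zero (μ ν : ProbabilityMeasure X) :
    μ.mix 0 ν = μ :=
  Subtype.ext (by simp [ProbabilityMeasure.toMeasure_mix])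

@[simp]
lemma MeasureTheory.ProbabilityMeasure.mix_one (μ ν : ProbabilityMeasure X) :
    μ.mix 1 ν = ν :=
  Subtype.ext (by simp [ProbabilityMeasure.toMeasure_mix])

lemma MeasureTheory.ProbabilityMeasure.mix_real (t : unitInterval)
    (μ ν : ProbabilityMeasure X) (s : Set X) :
    (μ.mix t ν : Measure X).real s =
      (1 - t) * (μ : Measure X).real s + t * (ν : Measure X).real s := by
  have h₁ : (0 : ℝ) ≤ 1 - t := sub_nonneg.2 t.2.2
  rw [ProbabilityMeasure.toMeasure_mix,
    measureReal_add_apply (by simp [ENNReal.mul_eq_top]) (by simp [ENNReal.mul_eq_top])]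
  simp [measureReal_ennreal_smul_apply, ENNReal.toReal_ofReal h₁, ENNReal.toReal_ofReal t.2.1]

variable [TopologicalSpace X] [OpensMeasurableSpace X]

lemma MeasureTheory.ProbabilityMeasure.continuous_mix :
    Continuous fun p : unitInterval × ProbabilityMeasure X × ProbabilityMeasure X ↦
      p.2.1.mix p.1 p.2.2 := by
  rw [ProbabilityMeasure.continuous_iff_forall_continuous_integral]
  intro f
  have key (p : unitInterval × ProbabilityMeasure X × ProbabilityMeasure X) :
      ∫ x, f x ∂(p.2.1.mix p.1 p.2.2 : Measure X) =
        (1 - p.1) * ∫ x, f x ∂(p.2.1 : Measure X) + p.1 * ∫ x, f x ∂(p.2.2 : Measure X) := by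
    have h₁ : (0 : ℝ) ≤ 1 - p.1 := sub_nonneg.2 p.1.2.2
    rw [ProbabilityMeasure.toMeasure_mix, integral_add_measure
      ((f.integrable _).smul_measure ENNReal.ofReal_ne_top)
      ((f.integrable _).smul_measure ENNReal.ofReal_ne_top)]
    simp [integral_smul_measure, ENNReal.toReal_ofReal h₁, ENNReal.toReal_ofReal p.1.2.1]
  simp_rw [key]
  have h := ProbabilityMeasure.continuous_integral_boundedContinuousFunction f
  have h₁ := h.comp (continuous_fst.comp (continuous_snd (X := unitInterval)
    (Y := ProbabilityMeasure X × ProbabilityMeasure X)))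
  have h₂ := h.comp (continuous_snd.comp (continuous_snd (X := unitInterval)
    (Y := ProbabilityMeasure X × ProbabilityMeasure X)))
  exact ((continuous_const.sub (continuous_subtype_val.comp continuous_fst)).mul h₁).add
    ((continuous_subtype_val.comp continuous_fst).mul h₂)

/-- Two continuous maps into a set of probability measures are homotopic when the segments
between their values stay in the set. -/
lemma ContinuousMap.homotopic_of_mix_mem {Y Z : Type*} [TopologicalSpace Y] [TopologicalSpace Z]
    {ι : Z → ProbabilityMeasure X} (hι : IsEmbedding ι) (f g : C(Y, Z))
    (h : ∀ t y, (ι (f y)).mix t (ι (g y)) ∈ range ι) : f.Homotopic g := by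
  choose H hH using h
  refine ⟨⟨⟨fun p ↦ H p.1 p.2, ?_⟩, fun y ↦ ?_, fun y ↦ ?_⟩⟩
  · rw [hι.continuous_iff]
    have : Continuous fun p : unitInterval × Y ↦ (ι (f p.2)).mix p.1 (ι (g p.2)) :=
      ProbabilityMeasure.continuous_mix.comp (continuous_fst.prodMk
        ((hι.continuous.comp (f.continuous.comp continuous_snd)).prodMk
          (hι.continuous.comp (g.continuous.comp continuous_snd))))
    simpa only [Function.comp_def, hH] using this
  · exact hι.injective (by simp [hH])
  · exact hι.injective (by simp [hH])

end ConvexCombination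

section Support

variable {X : Type*} [TopologicalSpace X] [MeasurableSpace X]

lemma msupp_eq_support (μ : ProbabilityMeasure X) : msupp μ = (μ : Measure X).support := by
  ext x
  rw [(nhds_basis_opens x).mem_measureSupport]
  simp only [msupp, mem_ofPred_eq, pos_iff_ne_zero]
  exact forall_congr' fun U ↦ by tauto

lemma msupp_mix_subset (t : unitInterval) (μ ν : ProbabilityMeasure X) :
    msupp (μ.mix t ν) ⊆ msupp μ ∪ msupp ν := by
  simp only [msupp_eq_support, ProbabilityMeasure.toMeasure_mix, Measure.support_add]
  exact union_subset_union (Measure.smul_absolutelyContinuous).support_mono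
    (Measure.smul_absolutelyContinuous).support_mono

end Support

section Reweight

variable {X : Type*} [TopologicalSpace X] [CompactSpace X] [MeasurableSpace X]
  [OpensMeasurableSpace X]

lemma ContinuousMap.integrable_probabilityMeasure (φ : C(X, ℝ)) (ν : ProbabilityMeasure X) :
    Integrable φ (ν : Measure X) :=
  (BoundedContinuousFunction.mkOfCompact φ).integrable _

/-- The probability measure proportional to `φ ν`. -/
noncomputable def MeasureTheory.ProbabilityMeasure.reweight (ν : ProbabilityMeasure X)
    (φ : C(X, ℝ)) (hφ : ∀ x, 0 ≤ φ x) (hν : 0 < ∫ x, φ x ∂(ν : Measure X)) :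
    ProbabilityMeasure X :=
  ⟨(ν : Measure X).withDensity fun x ↦ ENNReal.ofReal (φ x / ∫ x, φ x ∂(ν : Measure X)), ⟨by
    rw [withDensity_apply _ MeasurableSet.univ, Measure.restrict_univ,
      ← ofReal_integral_eq_lintegral_ofReal ((φ.integrable_probabilityMeasure ν).div_const _)
        (ae_of_all _ fun x ↦ div_nonneg (hφ x) hν.le), integral_div, div_self hν.ne',
      ENNReal.ofReal_one]⟩⟩

variable {φ : C(X, ℝ)} {hφ : ∀ x, 0 ≤ φ x}

lemma MeasureTheory.ProbabilityMeasure.toMeasure_reweight (ν : ProbabilityMeasure X)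
    (hν : 0 < ∫ x, φ x ∂(ν : Measure X)) :
    (ν.reweight φ hφ hν : Measure X) = (ν : Measure X).withDensity
      fun x ↦ ENNReal.ofReal (φ x / ∫ x, φ x ∂(ν : Measure X)) :=
  rfl

lemma MeasureTheory.ProbabilityMeasure.continuous_reweight {Y : Type*} [TopologicalSpace Y]
    {ν : Y → ProbabilityMeasure X} (hc : Continuous ν)
    (hν : ∀ y, 0 < ∫ x, φ x ∂(ν y : Measure X)) :
    Continuous fun y ↦ (ν y).reweight φ hφ (hν y) := by
  rw [ProbabilityMeasure.continuous_iff_forall_continuousMap_continuous_integral]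
  intro f
  have key (y : Y) : ∫ x, f x ∂((ν y).reweight φ hφ (hν y) : Measure X) =
      (∫ x, (φ * f) x ∂(ν y : Measure X)) / ∫ x, φ x ∂(ν y : Measure X) := by
    rw [ProbabilityMeasure.toMeasure_reweight, integral_withDensity_eq_integral_toReal_smul
      (by fun_prop) (ae_of_all _ fun _ ↦ ENNReal.ofReal_lt_top), ← integral_div]
    congr 1 with x
    rw [ENNReal.toReal_ofReal (div_nonneg (hφ x) (hν y).le), ContinuousMap.mul_apply, smul_eq_mul]
    ring
  simp_rw [key]
  exact ((ProbabilityMeasure.continuous_integral_continuousMap (φ * f)).comp hc).div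
    ((ProbabilityMeasure.continuous_integral_continuousMap φ).comp hc) fun y ↦ (hν y).ne'

lemma MeasureTheory.ProbabilityMeasure.real_le_reweight_real (ν : ProbabilityMeasure X)
    (hν : 0 < ∫ x, φ x ∂(ν : Measure X)) (hφ1 : ∀ x, φ x ≤ 1) {s : Set X}
    (hs : MeasurableSet s) (hφs : EqOn φ 1 s) :
    (ν : Measure X).real s ≤ (ν.reweight φ hφ hν : Measure X).real s := by
  refine ENNReal.toReal_mono (measure_ne_top _ _) ?_
  have hc : ∫ x, φ x ∂(ν : Measure X) ≤ 1 := by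
    simpa using integral_mono (φ.integrable_probabilityMeasure ν) (integrable_const (1 : ℝ)) hφ1
  rw [ProbabilityMeasure.toMeasure_reweight, withDensity_apply _ hs, ← setLIntegral_one]
  refine setLIntegral_mono' hs fun x hx ↦ ?_
  rw [hφs hx, Pi.one_apply, ENNReal.one_le_ofReal]
  exact (one_le_div hν).2 hc

lemma real_le_integral_of_eqOn_one (ν : ProbabilityMeasure X) (hφ : ∀ x, 0 ≤ φ x) {s : Set X}
    (hs : MeasurableSet s) (hφs : EqOn φ 1 s) :
    (ν : Measure X).real s ≤ ∫ x, φ x ∂(ν : Measure X) := by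
  rw [← integral_indicator_one hs]
  refine integral_mono ((integrable_const (1 : ℝ)).indicator hs)
    (φ.integrable_probabilityMeasure ν) fun x ↦ ?_
  by_cases hx : x ∈ s
  · simp [hx, hφs hx]
  · simp [hx, hφ x]

lemma msupp_reweight_subset (ν : ProbabilityMeasure X)
    (hν : 0 < ∫ x, φ x ∂(ν : Measure X)) :
    msupp (ν.reweight φ hφ hν) ⊆ msupp ν ∩ tsupport φ := by
  refine subset_inter ?_ fun x hx ↦ ?_
  · simp only [msupp_eq_support]
    exact (withDensity_absolutelyContinuous _ _).support_mono
  · by_contra hxφ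
    have ho : IsOpen (tsupport φ)ᶜ := (isClosed_tsupport φ).isOpen_compl
    refine hx _ ho hxφ ?_
    rw [ProbabilityMeasure.toMeasure_reweight, withDensity_apply _ ho.measurableSet,
      setLIntegral_eq_zero ho.measurableSet]
    intro x hx
    simp [image_eq_zero_of_notMem_tsupport hx]

end Reweight

section LevyProkhorov

variable {X : Type*} [PseudoMetricSpace X] [MeasurableSpace X] [OpensMeasurableSpace X]
  [MeasurableSingletonClass X]

/-- A probability measure having, up to a factor `1 - ε`, the mass of each atom of a finitely
supported measure in its `ε`-ball is close to that measure. -/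
lemma levyProkhorovDist_le_of_finite_support (μ ν : Measure X) [IsProbabilityMeasure μ]
    [IsProbabilityMeasure ν] {S : Finset X} (hS : μ (S : Set X)ᶜ = 0) {N : X → Set X} {ε : ℝ}
    (hε : 0 ≤ ε) (hNm : ∀ x ∈ S, MeasurableSet (N x)) (hN : ∀ x ∈ S, N x ⊆ Metric.ball x ε)
    (hdisj : (S : Set X).PairwiseDisjoint N)
    (hν : ∀ x ∈ S, (1 - ε) * μ.real {x} ≤ ν.real (N x)) :
    levyProkhorovDist μ ν ≤ ε := by
  classical
  refine levyProkhorovDist_le_of_forall_le μ ν hε fun e B he hB ↦ ?_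
  have hμB : μ.real B = ∑ x ∈ S with x ∈ B, μ.real {x} := by
    rw [sum_measureReal_singleton, ← measureReal_inter_add_sdiff (s := B) S.measurableSet,
      show μ.real (B \ S) = 0 by
        simp [measureReal_def, measure_mono_null (fun x hx ↦ hx.2 : B \ (S : Set X) ⊆ _) hS],
      add_zero]
    congr 1
    ext x
    simp [and_comm]
  have hνB : ∑ x ∈ S with x ∈ B, ν.real (N x) ≤ ν.real (Metric.thickening e B) := by
    rw [← measureReal_biUnion_finset (fun x hx y hy hxy ↦ hdisj (Finset.mem_filter.1 hx).1
      (Finset.mem_filter.1 hy).1 hxy) fun x hx ↦ hNm x (Finset.mem_filter.1 hx).1]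
    refine measureReal_mono (iUnion₂_subset fun x hx ↦ ?_)
    obtain ⟨hxS, hxB⟩ := Finset.mem_filter.1 hx
    exact (hN x hxS).trans ((Metric.ball_subset_ball he.le).trans
      (Metric.ball_subset_thickening hxB e))
  have hsum : (1 - ε) * μ.real B ≤ ∑ x ∈ S with x ∈ B, ν.real (N x) := by
    rw [hμB, Finset.mul_sum]
    exact Finset.sum_le_sum fun x hx ↦ hν x (Finset.mem_filter.1 hx).1
  have h1 : μ.real B ≤ 1 := measureReal_le_one
  have hreal : μ.real B ≤ ν.real (Metric.thickening e B) + e := by nlinarith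
  rw [← ofReal_measureReal (μ := μ), ← ofReal_measureReal (μ := ν),
    ← ENNReal.ofReal_add measureReal_nonneg (hε.trans he.le)]
  exact ENNReal.ofReal_le_ofReal hreal

end LevyProkhorov

lemma MeasureTheory.ProbabilityMeasure.eventually_lt_real {X : Type*} [PseudoMetricSpace X]
    [MeasurableSpace X] [OpensMeasurableSpace X] (μ : ProbabilityMeasure X) {G : Set X}
    (hG : IsOpen G) {c : ℝ} (hc : c < (μ : Measure X).real G) :
    ∀ᶠ ν : ProbabilityMeasure X in 𝓝 μ, c < (ν : Measure X).real G := by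
  have hpos : 0 < ENNReal.ofReal ((μ : Measure X).real G - c) := by simpa using hc
  filter_upwards [μ.toMeasure_add_pos_gt_mem_nhds hG hpos] with ν hν
  change (μ : Measure X) G < (ν : Measure X) G + _ at hν
  rw [← ofReal_measureReal (μ := (μ : Measure X)), ← ofReal_measureReal (μ := (ν : Measure X)),
    ← ENNReal.ofReal_add measureReal_nonneg (sub_nonneg.2 hc.le),
    ENNReal.ofReal_lt_ofReal_iff_of_nonneg measureReal_nonneg] at hν
  linarith

theorem stmt_11 {X : Type*} [MetricSpace X] [CompactSpace X] [MeasurableSpace X] [BorelSpace X]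
    (𝒲 : Set (Set X)) (hWopen : ∀ W ∈ 𝒲, IsOpen W) (hWcover : ⋃₀ 𝒲 = Set.univ)
    (D : ℝ) (hD : 0 < D) (hWbdd : ∀ W ∈ 𝒲, Metric.diam W < D)
    (μ : VietorisThickening 𝒲) (U : Set (VietorisThickening 𝒲)) (hU : U ∈ nhds μ) :
    ∃ V : Set (VietorisThickening 𝒲), V ∈ nhds μ ∧ V ⊆ U ∧ ContractibleSpace V := by
  obtain ⟨μ, hμfin, W, hW, hμW⟩ := μ
  obtain ⟨U', hU', hU'U⟩ := mem_nhds_subtype _ _ _ |>.1 hU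
  obtain ⟨ε₀, hε₀, hball⟩ : ∃ ε > 0, ∀ ν : ProbabilityMeasure X,
      levyProkhorovDist (μ : Measure X) ν < ε → ν ∈ U' := by
    have h := (LevyProkhorov.probabilityMeasureHomeomorph (Ω := X)).symm.continuous.continuousAt
      (x := LevyProkhorov.ofMeasure μ) hU'
    obtain ⟨ε, hε, h⟩ := Metric.mem_nhds_iff.1 h
    refine ⟨ε, hε, fun ν hν ↦ h (a := LevyProkhorov.ofMeasure ν) ?_⟩
    rw [Metric.mem_ball, LevyProkhorov.dist_probabilityMeasure_def, levyProkhorovDist_comm]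
    exact hν
  obtain ⟨ε, hε, hε'⟩ : ∃ ε > 0, ε < min ε₀ 1 := exists_between (lt_min hε₀ one_pos)
  obtain ⟨hεε₀, hε1⟩ := lt_min_iff.1 hε'
  have hnull : (μ : Measure X) (msupp μ)ᶜ = 0 := by
    rw [msupp_eq_support]
    exact Measure.measure_compl_support
  obtain ⟨x₀, hx₀⟩ : (msupp μ).Nonempty := by
    rw [msupp_eq_support]
    exact Measure.nonempty_support (IsProbabilityMeasure.ne_zero _)
  obtain ⟨T, hT, hTdisj⟩ := hμfin.t2_separation
  obtain ⟨W', hW'o, hSW', hW'W⟩ := normal_exists_closure_subset hμfin.isClosed (hWopen W hW) hμW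
  obtain ⟨φ, hφW, hφ1, hφ01⟩ := exists_tsupport_one_of_isOpen_isClosed (hWopen W hW)
    isClosed_closure.isCompact isClosed_closure hW'W
  let N : X → Set X := fun x ↦ Metric.ball x ε ∩ T x ∩ W'
  have hNo (x : X) : IsOpen (N x) := (Metric.isOpen_ball.inter (hT x).2).inter hW'o
  have hNx {x : X} (hx : x ∈ msupp μ) : x ∈ N x :=
    ⟨⟨Metric.mem_ball_self hε, (hT x).1⟩, hSW' hx⟩
  have hNφ (x : X) : EqOn φ 1 (N x) := hφ1.mono fun y hy ↦ subset_closure hy.2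
  have hNdisj : (msupp μ).PairwiseDisjoint N :=
    hTdisj.mono fun x y hy ↦ hy.1.2
  have hφ0 (x : X) : 0 ≤ φ x := (hφ01 x).1
  have hpos {x : X} (hx : x ∈ msupp μ) : 0 < (μ : Measure X).real {x} := by
    refine ENNReal.toReal_pos (fun h ↦ hx _ ((hNo x)) (hNx hx) ?_) (measure_ne_top _ _)
    refine measure_mono_null (fun y hy ↦ ?_) (measure_union_null h hnull)
    by_contra! hy'
    simp only [mem_union, mem_singleton_iff, mem_compl_iff, not_or, not_not] at hy'
    exact Set.disjoint_left.1 (hNdisj hy'.2 hx hy'.1) (hNx hy'.2) hy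
  let P : Set (ProbabilityMeasure X) :=
    {ν | ∀ x ∈ msupp μ, (1 - ε) * (μ : Measure X).real {x} < (ν : Measure X).real (N x)}
  have hμP : μ ∈ P := fun x hx ↦ by
    have := measureReal_mono (μ := (μ : Measure X)) (singleton_subset_iff.2 (hNx hx))
    nlinarith [hpos hx]
  have hPconv {ν ν' : ProbabilityMeasure X} (hν : ν ∈ P) (hν' : ν' ∈ P) (t : unitInterval) :
      ν.mix t ν' ∈ P := fun x hx ↦ by
    rw [ProbabilityMeasure.mix_real]
    exact convex_Ioi ((1 - ε) * (μ : Measure X).real {x}) (mem_Ioi.2 (hν x hx))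
      (mem_Ioi.2 (hν' x hx)) (sub_nonneg.2 t.2.2) t.2.1 (by simp)
  have hφpos {ν : ProbabilityMeasure X} (hν : ν ∈ P) : 0 < ∫ x, φ x ∂(ν : Measure X) :=
    (mul_pos (sub_pos.2 hε1) (hpos hx₀)).trans ((hν x₀ hx₀).trans_le
      (real_le_integral_of_eqOn_one ν hφ0 (hNo x₀).measurableSet (hNφ x₀)))
  let V : Set (VietorisThickening 𝒲) := {ν | (ν : ProbabilityMeasure X) ∈ P}
  let ι : V → ProbabilityMeasure X := fun ν ↦ ν.1.1
  have hι : IsEmbedding ι := IsEmbedding.subtypeVal.comp IsEmbedding.subtypeVal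
  have hmem {ν : ProbabilityMeasure X} (hν : ν ∈ P) (hfin : (msupp ν).Finite) {W : Set X}
      (hW : W ∈ 𝒲) (hνW : msupp ν ⊆ W) : ν ∈ range ι :=
    ⟨⟨⟨ν, hfin, W, hW, hνW⟩, hν⟩, rfl⟩
  have hRP (ν : V) : (ι ν).reweight φ hφ0 (hφpos ν.2) ∈ P := fun x hx ↦
    (ν.2 x hx).trans_le (ProbabilityMeasure.real_le_reweight_real _ _ (fun x ↦ (hφ01 x).2)
      (hNo x).measurableSet (hNφ x))
  have hRsub (ν : V) : msupp ((ι ν).reweight φ hφ0 (hφpos ν.2)) ⊆ msupp (ι ν) :=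
    (msupp_reweight_subset _ _).trans inter_subset_left
  have hRW (ν : V) : msupp ((ι ν).reweight φ hφ0 (hφpos ν.2)) ⊆ W :=
    ((msupp_reweight_subset _ _).trans inter_subset_right).trans hφW
  let R : C(V, V) :=
    { toFun := fun ν ↦ ⟨⟨(ι ν).reweight φ hφ0 (hφpos ν.2),
        ν.1.2.1.subset (hRsub ν), W, hW, hRW ν⟩, hRP ν⟩
      continuous_toFun := ((ProbabilityMeasure.continuous_reweight hι.continuous
        fun ν ↦ hφpos ν.2).subtype_mk _).subtype_mk _ }
  let μV : V := ⟨⟨μ, hμfin, W, hW, hμW⟩, hμP⟩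
  refine ⟨V, ?_, fun ν hν ↦ hU'U (hball _ ?_), ?_⟩
  · have hP : P ∈ 𝓝 μ := (Filter.eventually_all_finite hμfin).2 fun x hx ↦
      μ.eventually_lt_real (hNo x) (hμP x hx)
    exact continuous_subtype_val.continuousAt.preimage_mem_nhds hP
  · refine (levyProkhorovDist_le_of_finite_support _ _ (S := hμfin.toFinset) (N := N)
      (by simpa using hnull) hε.le (fun x _ ↦ (hNo x).measurableSet) (fun x _ y hy ↦ hy.1.1)
      (by simpa using hNdisj) fun x hx ↦ (hν x (by simpa using hx)).le).trans_lt hεε₀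
  · rw [contractible_iff_id_nullhomotopic]
    refine ⟨μV, (ContinuousMap.homotopic_of_mix_mem hι _ R fun t ν ↦ ?_).trans
      (ContinuousMap.homotopic_of_mix_mem hι _ _ fun t ν ↦ ?_)⟩
    · obtain ⟨W₁, hW₁, hνW₁⟩ := ν.1.2.2
      have hsub : msupp ((ι ν).mix t (ι (R ν))) ⊆ msupp (ι ν) :=
        (msupp_mix_subset _ _ _).trans (union_subset subset_rfl (hRsub ν))
      exact hmem (hPconv ν.2 (hRP ν) t) (ν.1.2.1.subset hsub) hW₁ (hsub.trans hνW₁)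
    · have hsub := msupp_mix_subset t (ι (R ν)) (ι μV)
      exact hmem (hPconv (hRP ν) hμP t) (((R ν).1.2.1.union hμfin).subset hsub) hW
        (hsub.trans (union_subset (hRW ν) hμW))
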